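/- Let M ≥ 1 be an integer, g > 0, τ > 0, λ ∈ (0,1). For r̃ ∈ ℂ^M define m_g(r̃) = (1−λ)·φ_{τ²}^{(M)}(r̃) + λ·φ_{g²+τ²}^{(M)}(r̃), the M×M matrices S_g(r̃) = λ·∫_{ℂ^M} r·r*·φ_{g²}^{(M)}(r)·φ_{τ²}^{(M)}(r̃−r) dr and B_g(r̃) = λ·∫_{ℂ^M} r·φ_{g²}^{(M)}(r)·φ_{τ²}^{(M)}(r̃−r) dr (r a column vector, r* its conjugate transpose). Then the integrated posterior covariance is a scalar multiple of the identity: ∫_{ℂ^M} (S_g(r̃) − B_g(r̃)·B_g(r̃)*/m_g(r̃)) dr̃ = c·I_M, where c = λ·g²·τ²/(g²+τ²) + (λ·g⁴/(g²+τ²))·(1 − φ̄_M(g²/τ²)/Γ(M+1)) and Γ is the Gamma function. -/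

import Mathlib

open MeasureTheory Set
open scoped ENNReal

noncomputable section

/-- `Q(g) = ∫_{b ln g + c}^∞ exp(-s²) ds`. -/
def Qfun (b c g : ℝ) : ℝ := ∫ s in Set.Ioi (b * Real.log g + c), Real.exp (-s ^ 2)

/-- Squared Euclidean norm on `ℂ^M ≅ ℝ^{2M}`. -/
def nsq {M : ℕ} (r : Fin M → ℂ) : ℝ := ∑ i, ‖r i‖ ^ 2

/-- Circularly symmetric complex Gaussian density of variance `v` on `ℂ^M ≅ ℝ^{2M}`:
`φ_v^{(M)}(r) = (πv)^{-M} exp(-‖r‖²/v)`. -/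
def vgauss (M : ℕ) (v : ℝ) (r : Fin M → ℂ) : ℝ :=
  ((Real.pi * v) ^ M)⁻¹ * Real.exp (-nsq r / v)

/-- Channel-row density `q_M(r) = a π^{-M} ∫₀^∞ g^{-γ-2M} Q(g) exp(-‖r‖²/g²) dg`. -/
def qM (a γ b c : ℝ) (M : ℕ) (r : Fin M → ℂ) : ℝ :=
  a / Real.pi ^ M *
    ∫ g in Set.Ioi (0 : ℝ), g ^ (-γ - 2 * (M : ℝ)) * Qfun b c g * Real.exp (-nsq r / g ^ 2)

attribute [local instance] Matrix.normedAddCommGroup Matrix.normedSpace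

/-- `φ̄_i(s) = ∫₀^∞ tⁱ e^{-t} / (1 + ((1-λ)/λ)(1+s)ⁱ e^{-st}) dt`. -/
def phibar (lam : ℝ) (i : ℕ) (s : ℝ) : ℝ :=
  ∫ t in Set.Ioi (0 : ℝ),
    t ^ i * Real.exp (-t) / (1 + (1 - lam) / lam * (1 + s) ^ i * Real.exp (-s * t))

open scoped Nat

lemma nsq_nonneg {M : ℕ} (r : Fin M → ℂ) : 0 ≤ nsq r := by
  unfold nsq; positivity

lemma continuous_nsq {M : ℕ} : Continuous (nsq : (Fin M → ℂ) → ℝ) := by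
  unfold nsq; fun_prop

lemma norm_apply_sq_le_nsq {M : ℕ} (r : Fin M → ℂ) (i : Fin M) : ‖r i‖ ^ 2 ≤ nsq r :=
  Finset.single_le_sum (f := fun i => ‖r i‖ ^ 2) (fun _ _ => by positivity) (Finset.mem_univ i)

/-- Lebesgue measure on `ℂ^M`, transported to the Euclidean space. -/
def euclVol (M : ℕ) : Measure (EuclideanSpace ℂ (Fin M)) :=
  Measure.map (PiLp.continuousLinearEquiv 2 ℝ (fun _ : Fin M => ℂ)).symm volume

instance (M : ℕ) : (euclVol M).IsAddHaarMeasure :=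
  ContinuousLinearEquiv.isAddHaarMeasure_map _ _

lemma measurableEmbedding_toLp (M : ℕ) :
    MeasurableEmbedding (PiLp.continuousLinearEquiv 2 ℝ (fun _ : Fin M => ℂ)).symm :=
  (PiLp.continuousLinearEquiv 2 ℝ
    (fun _ : Fin M => ℂ)).symm.toHomeomorph.measurableEmbedding

lemma norm_toLp_eq_sqrt_nsq {M : ℕ} (r : Fin M → ℂ) :
    ‖(PiLp.continuousLinearEquiv 2 ℝ (fun _ : Fin M => ℂ)).symm r‖ = √(nsq r) := by
  rw [EuclideanSpace.norm_eq]; rfl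

lemma finrank_real_euclideanSpace_complex (M : ℕ) :
    Module.finrank ℝ (EuclideanSpace ℂ (Fin M)) = 2 * M := by
  rw [← Module.finrank_mul_finrank ℝ ℂ]; simp

lemma euclVol_real_ball (M : ℕ) :
    (euclVol M).real (Metric.ball 0 1) = Real.pi ^ M / M ! := by
  have h := Complex.volume_sum_rpow_lt_one (Fin M) (p := 2) (by norm_num)
  rw [Measure.real, euclVol, (measurableEmbedding_toLp M).map_apply]
  have hs : (PiLp.continuousLinearEquiv 2 ℝ (fun _ : Fin M => ℂ)).symm ⁻¹' Metric.ball 0 1 =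
      {x | ∑ i, ‖x i‖ ^ (2 : ℝ) < 1} := by
    ext r
    simp only [mem_preimage, mem_ball_zero_iff, norm_toLp_eq_sqrt_nsq, mem_ofPred_eq]
    rw [Real.sqrt_lt' one_pos, one_pow]
    simp [nsq]
  rw [hs, h, ENNReal.toReal_ofReal (div_nonneg (pow_nonneg (mul_nonneg Real.pi_nonneg
    (Real.Gamma_nonneg_of_nonneg (by norm_num))) _) (Real.Gamma_nonneg_of_nonneg (by positivity)))]
  have e1 : (2 : ℝ) / 2 + 1 = (1 : ℕ) + 1 := by norm_num
  have e2 : (2 : ℝ) * (Fintype.card (Fin M)) / 2 + 1 = M + 1 := by simp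
  rw [e1, e2, Real.Gamma_nat_eq_factorial, Real.Gamma_nat_eq_factorial]
  simp

/-- Integration of a radial function on `ℂ^M` in polar coordinates. -/
lemma integral_comp_nsq {M : ℕ} (hM : 1 ≤ M) (f : ℝ → ℝ) :
    ∫ r : Fin M → ℂ, f (nsq r) =
      M * (Real.pi ^ M / M !) * ∫ t in Ioi (0 : ℝ), t ^ (M - 1) * f t := by
  have : Nonempty (Fin M) := ⟨⟨0, hM⟩⟩
  have h := integral_fun_norm_addHaar (euclVol M) (fun y => f (y ^ 2))
  rw [euclVol, (measurableEmbedding_toLp M).integral_map, ← euclVol, euclVol_real_ball,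
    finrank_real_euclideanSpace_complex] at h
  simp only [norm_toLp_eq_sqrt_nsq, Real.sq_sqrt (nsq_nonneg _)] at h
  rw [h, ← integral_comp_rpow_Ioi (fun t => t ^ (M - 1) * f t) (p := 2) (by norm_num)]
  have : ∀ y ∈ Ioi (0 : ℝ), (|(2 : ℝ)| * y ^ ((2 : ℝ) - 1)) •
      ((y ^ (2 : ℝ)) ^ (M - 1) * f (y ^ (2 : ℝ))) = 2 * (y ^ (2 * M - 1) • f (y ^ 2)) := by
    intro y _
    have e : 2 * M - 1 = 2 * (M - 1) + 1 := by omega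
    norm_num [e, pow_succ, pow_mul]
    ring
  rw [setIntegral_congr_fun measurableSet_Ioi this, integral_const_mul]
  simp only [nsmul_eq_mul, smul_eq_mul]
  push_cast
  ring

lemma integrable_nsq_pow_mul_exp {M : ℕ} (hM : 1 ≤ M) {v : ℝ} (hv : 0 < v) (k : ℕ) :
    Integrable (fun r : Fin M → ℂ => nsq r ^ k * Real.exp (-nsq r / v)) := by
  have : Nonempty (Fin M) := ⟨⟨0, hM⟩⟩
  have h := (integrable_fun_norm_addHaar (euclVol M)
    (f := fun y => (y ^ 2) ^ k * Real.exp (-y ^ 2 / v))).2 (by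
      rw [finrank_real_euclideanSpace_complex]
      refine (integrableOn_rpow_mul_exp_neg_mul_sq (inv_pos.2 hv)
        (s := ((2 * M - 1 + 2 * k : ℕ) : ℝ)) (by linarith [Nat.cast_nonneg (α := ℝ) (2 * M - 1 + 2 * k)])).congr_fun
          ?_ measurableSet_Ioi
      intro y _
      simp only [Real.rpow_natCast, smul_eq_mul, pow_add, pow_mul]
      rw [show -v⁻¹ * y ^ 2 = -y ^ 2 / v by ring]
      ring)
  rw [euclVol, (measurableEmbedding_toLp M).integrable_map_iff] at h
  simpa only [Function.comp_def, norm_toLp_eq_sqrt_nsq, Real.sq_sqrt (nsq_nonneg _)] using h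

lemma integral_radial_mul_eq_zero {M : ℕ} (f : ℝ → ℝ) {i j : Fin M} (hij : i ≠ j) :
    ∫ r : Fin M → ℂ, (f (nsq r) : ℂ) * (r i * star (r j)) = 0 := by
  let e : (Fin M → ℂ) ≃ᵐ (Fin M → ℂ) := MeasurableEquiv.piCongrRight fun k =>
    if k = i then MeasurableEquiv.neg ℂ else MeasurableEquiv.refl ℂ
  have he : ∀ r k, e r k = if k = i then -r k else r k := by
    intro r k
    by_cases h : k = i <;> simp [e, h, MeasurableEquiv.piCongrRight]
  have hp : MeasurePreserving e volume volume := by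
    refine volume_preserving_pi (f := fun k => ⇑(if k = i then MeasurableEquiv.neg ℂ else
      MeasurableEquiv.refl ℂ)) fun k => ?_
    by_cases h : k = i
    · simpa [h] using Measure.measurePreserving_neg (volume : Measure ℂ)
    · rw [if_neg h]
      exact MeasurePreserving.id _
  have hn : ∀ r, nsq (e r) = nsq r := by
    intro r
    unfold nsq
    refine Finset.sum_congr rfl fun k _ => ?_
    rw [he]; split_ifs <;> simp
  have h := hp.integral_comp' (fun r => (f (nsq r) : ℂ) * (r i * star (r j)))
  simp only [hn, he, if_pos, if_neg hij.symm] at h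
  have h2 : ∫ r : Fin M → ℂ, (f (nsq r) : ℂ) * (-r i * star (r j)) =
      -∫ r : Fin M → ℂ, (f (nsq r) : ℂ) * (r i * star (r j)) := by
    rw [← integral_neg]; congr 1; ext r; ring
  rw [h2] at h
  exact self_eq_neg.1 h.symm

lemma integral_radial_mul_norm_sq_comm {M : ℕ} (f : ℝ → ℝ) (i j : Fin M) :
    ∫ r : Fin M → ℂ, f (nsq r) * ‖r i‖ ^ 2 = ∫ r : Fin M → ℂ, f (nsq r) * ‖r j‖ ^ 2 := by
  have hp := volume_preserving_arrowCongr' (Equiv.swap i j) (MeasurableEquiv.refl ℂ)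
    (MeasurePreserving.id _)
  have he : ∀ r k, MeasurableEquiv.arrowCongr' (Equiv.swap i j) (MeasurableEquiv.refl ℂ) r k =
      r (Equiv.swap i j k) := fun r k => rfl
  rw [← hp.integral_comp']
  have hn : ∀ r, nsq (MeasurableEquiv.arrowCongr' (Equiv.swap i j) (MeasurableEquiv.refl ℂ) r) =
      nsq r := fun r => Equiv.sum_comp (Equiv.swap i j) (fun k => ‖r k‖ ^ 2)
  simp only [hn, he, Equiv.swap_apply_left]

/-- Second moments of a radial density on `ℂ^M`. -/
lemma integral_radial_mul {M : ℕ} (hM : 1 ≤ M) (f : ℝ → ℝ)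
    (hf : ∀ i, Integrable (fun r : Fin M → ℂ => f (nsq r) * ‖r i‖ ^ 2)) (i j : Fin M) :
    ∫ r : Fin M → ℂ, (f (nsq r) : ℂ) * (r i * star (r j)) =
      ((Real.pi ^ M / M ! * ∫ t in Ioi (0 : ℝ), t ^ M * f t : ℝ) : ℂ) *
        (1 : Matrix (Fin M) (Fin M) ℂ) i j := by
  by_cases hij : i = j
  · subst hij
    have h1 : ∀ r : Fin M → ℂ, (f (nsq r) : ℂ) * (r i * star (r i)) =
        ((f (nsq r) * ‖r i‖ ^ 2 : ℝ) : ℂ) := by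
      intro r
      rw [← starRingEnd_apply, Complex.mul_conj']
      push_cast; rfl
    simp only [h1, Matrix.one_apply_eq, mul_one]
    rw [integral_complex_ofReal]
    congr 1
    have hM0 : (M : ℝ) ≠ 0 := by positivity
    have h2 : (M : ℝ) * ∫ r : Fin M → ℂ, f (nsq r) * ‖r i‖ ^ 2 =
        ∫ r : Fin M → ℂ, f (nsq r) * nsq r := by
      have e : ∀ r : Fin M → ℂ, f (nsq r) * nsq r = ∑ k, f (nsq r) * ‖r k‖ ^ 2 :=
        fun r => Finset.mul_sum _ _ _
      simp only [e]
      rw [integral_finsetSum _ fun k _ => hf k,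
        Finset.sum_congr rfl fun k _ => integral_radial_mul_norm_sq_comm f k i]
      simp
    rw [integral_comp_nsq hM (fun t => f t * t)] at h2
    have h3 : ∫ t in Ioi (0 : ℝ), t ^ M * f t = ∫ t in Ioi (0 : ℝ), t ^ (M - 1) * (f t * t) := by
      congr 1; ext t
      obtain ⟨n, rfl⟩ : ∃ n, M = n + 1 := ⟨M - 1, by omega⟩
      simp [pow_succ]; ring
    rw [h3]
    refine mul_left_cancel₀ hM0 (h2.trans (by ring))
  · rw [integral_radial_mul_eq_zero f hij, Matrix.one_apply_ne hij, mul_zero]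

lemma vgauss_nonneg (M : ℕ) {v : ℝ} (hv : 0 < v) (r : Fin M → ℂ) : 0 ≤ vgauss M v r := by
  have := Real.pi_pos
  unfold vgauss; positivity

lemma vgauss_pos (M : ℕ) {v : ℝ} (hv : 0 < v) (r : Fin M → ℂ) : 0 < vgauss M v r := by
  have := Real.pi_pos
  unfold vgauss; positivity

lemma continuous_vgauss (M : ℕ) (v : ℝ) : Continuous (vgauss M v) := by
  have := continuous_nsq (M := M)
  unfold vgauss; fun_prop

lemma integrable_vgauss_mul {M : ℕ} (hM : 1 ≤ M) {v : ℝ} (hv : 0 < v)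
    {h : (Fin M → ℂ) → ℂ} (hc : Continuous h) (hle : ∀ r, ‖h r‖ ≤ 1 + nsq r) :
    Integrable (fun r => (vgauss M v r : ℂ) * h r) := by
  have h0 := integrable_nsq_pow_mul_exp hM hv 0
  have h1 := integrable_nsq_pow_mul_exp hM hv 1
  refine ((h0.add h1).const_mul ((Real.pi * v) ^ M)⁻¹).mono'
    ((Complex.continuous_ofReal.comp (continuous_vgauss M v)).mul hc).aestronglyMeasurable
    (Filter.Eventually.of_forall fun r => ?_)
  rw [norm_mul, Complex.norm_real, Real.norm_of_nonneg (vgauss_nonneg M hv r)]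
  refine (mul_le_mul_of_nonneg_left (hle r) (vgauss_nonneg M hv r)).trans_eq ?_
  simp only [vgauss, Pi.add_apply, pow_zero, pow_one]
  ring

lemma norm_apply_le_one_add_nsq {M : ℕ} (r : Fin M → ℂ) (i : Fin M) : ‖r i‖ ≤ 1 + nsq r := by
  nlinarith [norm_apply_sq_le_nsq r i, sq_nonneg (‖r i‖ - 1)]

lemma norm_apply_mul_star_le_nsq {M : ℕ} (r : Fin M → ℂ) (i j : Fin M) :
    ‖r i * star (r j)‖ ≤ nsq r := by
  rw [norm_mul, norm_star]
  nlinarith [norm_apply_sq_le_nsq r i, norm_apply_sq_le_nsq r j, sq_nonneg (‖r i‖ - ‖r j‖)]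

lemma integral_pow_mul_exp_neg_div (n : ℕ) {v : ℝ} (hv : 0 < v) :
    ∫ t in Ioi (0 : ℝ), t ^ n * Real.exp (-t / v) = v ^ (n + 1) * n ! := by
  have h := Real.integral_rpow_mul_exp_neg_mul_Ioi (a := (n : ℝ) + 1) (r := v⁻¹)
    (by positivity) (inv_pos.2 hv)
  rw [Real.Gamma_nat_eq_factorial] at h
  simp only [add_sub_cancel_right, Real.rpow_natCast, one_div, inv_inv] at h
  rw [show (n : ℝ) + 1 = ((n + 1 : ℕ) : ℝ) by push_cast; rfl, Real.rpow_natCast] at h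
  rw [← h]
  congr 1; ext t
  rw [show -t / v = -(v⁻¹ * t) by ring]

lemma integral_vgauss {M : ℕ} (hM : 1 ≤ M) {v : ℝ} (hv : 0 < v) :
    ∫ r : Fin M → ℂ, (vgauss M v r : ℂ) = 1 := by
  rw [integral_complex_ofReal]
  simp only [vgauss]
  rw [integral_const_mul, integral_comp_nsq hM (fun t => Real.exp (-t / v)),
    integral_pow_mul_exp_neg_div _ hv]
  obtain ⟨n, rfl⟩ : ∃ n, M = n + 1 := ⟨M - 1, by omega⟩
  norm_cast
  have := Real.pi_pos
  rw [Nat.factorial_succ, mul_pow]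
  simp only [Nat.add_sub_cancel]
  push_cast
  field_simp

lemma integral_vgauss_mul_apply {M : ℕ} (v : ℝ) (i : Fin M) :
    ∫ r : Fin M → ℂ, (vgauss M v r : ℂ) * r i = 0 := by
  have h := integral_neg_eq_self (fun r : Fin M → ℂ => (vgauss M v r : ℂ) * r i) volume
  have hn : ∀ r : Fin M → ℂ, vgauss M v (-r) = vgauss M v r := by
    intro r; simp [vgauss, nsq]
  simp only [hn, Pi.neg_apply, mul_neg] at h
  rw [integral_neg] at h
  exact self_eq_neg.1 h.symm

lemma integral_vgauss_mul_star_apply {M : ℕ} (v : ℝ) (i : Fin M) :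
    ∫ r : Fin M → ℂ, (vgauss M v r : ℂ) * star (r i) = 0 := by
  have h := integral_conj (μ := volume) (f := fun r : Fin M → ℂ => (vgauss M v r : ℂ) * r i)
  simpa [integral_vgauss_mul_apply] using h

lemma integral_vgauss_mul_apply_mul_star {M : ℕ} (hM : 1 ≤ M) {v : ℝ} (hv : 0 < v)
    (i j : Fin M) :
    ∫ r : Fin M → ℂ, (vgauss M v r : ℂ) * (r i * star (r j)) =
      (v : ℂ) * (1 : Matrix (Fin M) (Fin M) ℂ) i j := by
  have hf : ∀ i, Integrable (fun r : Fin M → ℂ => vgauss M v r * ‖r i‖ ^ 2) := by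
    intro i
    have h := (integrable_vgauss_mul hM hv (h := fun r => r i * star (r i)) (by fun_prop)
      (fun r => (norm_apply_mul_star_le_nsq r i i).trans (by linarith))).re
    refine h.congr (Filter.Eventually.of_forall fun r => ?_)
    simp only [← starRingEnd_apply, Complex.mul_conj']
    norm_cast
  have h := integral_radial_mul hM
    (fun t => ((Real.pi * v) ^ M)⁻¹ * Real.exp (-t / v)) hf i j
  simp only [vgauss]
  rw [h]
  congr 2
  have e : ∀ t : ℝ, t ^ M * (((Real.pi * v) ^ M)⁻¹ * Real.exp (-t / v)) =
    ((Real.pi * v) ^ M)⁻¹ * (t ^ M * Real.exp (-t / v)) := fun t => by ring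
  simp only [e]
  rw [integral_const_mul, integral_pow_mul_exp_neg_div _ hv, mul_pow, pow_succ]
  have := Real.pi_pos
  field_simp

/-- The product of a Gaussian prior and a Gaussian likelihood factors as evidence times
posterior. -/
lemma vgauss_mul_vgauss_sub {M : ℕ} {a b : ℝ} (ha : 0 < a) (hb : 0 < b) (rt r : Fin M → ℂ) :
    vgauss M a r * vgauss M b (rt - r) =
      vgauss M (a + b) rt * vgauss M (a * b / (a + b)) (r - (a / (a + b)) • rt) := by
  have hq : -nsq r / a + -nsq (rt - r) / b =
      -nsq rt / (a + b) + -nsq (r - (a / (a + b)) • rt) / (a * b / (a + b)) := by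
    simp only [nsq, ← Finset.sum_neg_distrib, Finset.sum_div, ← Finset.sum_add_distrib]
    refine Finset.sum_congr rfl fun k _ => ?_
    simp only [← Complex.normSq_eq_norm_sq, Complex.normSq_apply, Pi.sub_apply, Pi.smul_apply,
      Complex.sub_re, Complex.sub_im, Complex.smul_re, Complex.smul_im, smul_eq_mul]
    field_simp
    ring
  simp only [vgauss]
  rw [mul_mul_mul_comm, mul_mul_mul_comm (((Real.pi * (a + b)) ^ M)⁻¹), ← Real.exp_add,
    ← Real.exp_add, hq, ← mul_inv, ← mul_inv, ← mul_pow, ← mul_pow]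
  congr 3
  field_simp

lemma integral_vgauss_mul_vgauss_sub_mul {M : ℕ} {a b : ℝ} (ha : 0 < a) (hb : 0 < b)
    (rt : Fin M → ℂ) (h : (Fin M → ℂ) → ℂ) :
    ∫ r : Fin M → ℂ, (vgauss M a r * vgauss M b (rt - r)) • h r =
      vgauss M (a + b) rt * ∫ r : Fin M → ℂ, (vgauss M (a * b / (a + b)) r : ℂ) *
        h (r + (a / (a + b)) • rt) := by
  have hs := integral_sub_right_eq_self (μ := volume) (fun r : Fin M → ℂ =>
    (vgauss M (a * b / (a + b)) r : ℂ) * h (r + (a / (a + b)) • rt)) ((a / (a + b)) • rt)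
  rw [← hs, ← integral_const_mul]
  congr 1; ext r
  rw [vgauss_mul_vgauss_sub ha hb, Complex.real_smul]
  simp only [sub_add_cancel]
  push_cast
  ring

lemma integral_posterior_apply {M : ℕ} (hM : 1 ≤ M) {a b : ℝ} (ha : 0 < a) (hb : 0 < b)
    (rt : Fin M → ℂ) (i : Fin M) :
    ∫ r : Fin M → ℂ, (vgauss M a r * vgauss M b (rt - r)) • r i =
      (vgauss M (a + b) rt : ℂ) * ((a / (a + b) : ℝ) * rt i) := by
  have hv : 0 < a * b / (a + b) := by positivity
  rw [integral_vgauss_mul_vgauss_sub_mul ha hb rt fun r => r i]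
  congr 1
  simp only [Pi.add_apply, Pi.smul_apply, mul_add, Complex.real_smul]
  have h0 := integrable_vgauss_mul hM hv (h := fun _ => 1) (by fun_prop)
    (fun r => by simpa using nsq_nonneg r)
  simp only [mul_one] at h0
  rw [integral_add (integrable_vgauss_mul hM hv (by fun_prop)
    (fun r => norm_apply_le_one_add_nsq r i)) (h0.mul_const _), integral_mul_const,
    integral_vgauss_mul_apply, integral_vgauss hM hv]
  ring

lemma integral_posterior_apply_mul_star {M : ℕ} (hM : 1 ≤ M) {a b : ℝ} (ha : 0 < a) (hb : 0 < b)
    (rt : Fin M → ℂ) (i j : Fin M) :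
    ∫ r : Fin M → ℂ, (vgauss M a r * vgauss M b (rt - r)) • (r i * star (r j)) =
      (vgauss M (a + b) rt : ℂ) * ((a * b / (a + b) : ℝ) * (1 : Matrix (Fin M) (Fin M) ℂ) i j +
        ((a / (a + b)) ^ 2 : ℝ) * (rt i * star (rt j))) := by
  have hv : 0 < a * b / (a + b) := by positivity
  rw [integral_vgauss_mul_vgauss_sub_mul ha hb rt fun r => r i * star (r j)]
  congr 1
  set κ : ℝ := a / (a + b)
  have h0 := integrable_vgauss_mul hM hv (h := fun _ => 1) (by fun_prop)
    (fun r => by simpa using nsq_nonneg r)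
  have h1 := integrable_vgauss_mul hM hv (h := fun r => r i) (by fun_prop)
    (fun r => norm_apply_le_one_add_nsq r i)
  have h2 := integrable_vgauss_mul hM hv (h := fun r => star (r j)) (by fun_prop)
    (fun r => by simpa using norm_apply_le_one_add_nsq r j)
  have h3 := integrable_vgauss_mul hM hv (h := fun r => r i * star (r j)) (by fun_prop)
    (fun r => (norm_apply_mul_star_le_nsq r i j).trans (by linarith))
  have e : ∀ r : Fin M → ℂ, (vgauss M (a * b / (a + b)) r : ℂ) *
      ((r + κ • rt) i * star ((r + κ • rt) j)) =
      (vgauss M (a * b / (a + b)) r * (r i * star (r j)) +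
        vgauss M (a * b / (a + b)) r * r i * (κ * star (rt j))) +
      (vgauss M (a * b / (a + b)) r * star (r j) * (κ * rt i) +
        vgauss M (a * b / (a + b)) r * 1 * (κ ^ 2 * (rt i * star (rt j)))) := by
    intro r
    simp only [Pi.add_apply, Pi.smul_apply, Complex.real_smul, ← starRingEnd_apply, map_add,
      map_mul, Complex.conj_ofReal]
    ring
  have h31 : Integrable (fun r : Fin M → ℂ =>
      (vgauss M (a * b / (a + b)) r * (r i * star (r j)) +
        vgauss M (a * b / (a + b)) r * r i * (κ * star (rt j)) : ℂ)) := h3.add (h1.mul_const _)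
  have h20 : Integrable (fun r : Fin M → ℂ =>
      (vgauss M (a * b / (a + b)) r * star (r j) * (κ * rt i) +
        vgauss M (a * b / (a + b)) r * 1 * (κ ^ 2 * (rt i * star (rt j))) : ℂ)) :=
    (h2.mul_const _).add (h0.mul_const _)
  simp only [e]
  rw [integral_add h31 h20,
    integral_add h3 (h1.mul_const _), integral_add (h2.mul_const _) (h0.mul_const _),
    integral_mul_const, integral_mul_const, integral_mul_const,
    integral_vgauss_mul_apply, integral_vgauss_mul_star_apply,
    integral_vgauss_mul_apply_mul_star hM hv]
  simp only [mul_one]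
  rw [integral_vgauss hM hv]
  push_cast
  ring

lemma Matrix.integral_apply {X : Type*} [MeasurableSpace X] {μ : Measure X} {M : ℕ}
    {F : X → Matrix (Fin M) (Fin M) ℂ} (hF : ∀ i j, Integrable (fun x => F x i j) μ)
    (i j : Fin M) : (∫ x, F x ∂μ) i j = ∫ x, F x i j ∂μ := by
  have h1 : ∀ i, Integrable (fun x => F x i) μ := fun i => Integrable.of_eval (hF i)
  exact (congrFun (eval_integral h1 i) j).trans (eval_integral (hF i) j)

/-- The inverse of the posterior odds factor: the evidence `m_g` equals
`λ φ_{a+b}(r̃)` times this function evaluated at `‖r̃‖²`. -/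
def oddsDenom (lam : ℝ) (M : ℕ) (a b t : ℝ) : ℝ :=
  1 + (1 - lam) / lam * (1 + a / b) ^ M * Real.exp (-(a / b) * (t / (a + b)))

lemma one_le_oddsDenom {lam : ℝ} (hlam : lam ∈ Ioo (0 : ℝ) 1) (M : ℕ) {a b : ℝ} (ha : 0 < a)
    (hb : 0 < b) (t : ℝ) : 1 ≤ oddsDenom lam M a b t := by
  have h1 := hlam.1
  have h2 : 0 < 1 - lam := sub_pos.2 hlam.2
  have : 0 ≤ (1 - lam) / lam * (1 + a / b) ^ M * Real.exp (-(a / b) * (t / (a + b))) := by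
    positivity
  unfold oddsDenom
  linarith

lemma mixture_eq {lam : ℝ} (hlam : lam ∈ Ioo (0 : ℝ) 1) (M : ℕ) {a b : ℝ} (ha : 0 < a)
    (hb : 0 < b) (r : Fin M → ℂ) :
    (1 - lam) * vgauss M b r + lam * vgauss M (a + b) r =
      lam * vgauss M (a + b) r * oddsDenom lam M a b (nsq r) := by
  have h1 := hlam.1.ne'
  have hpi := Real.pi_pos
  have hv : vgauss M b r = vgauss M (a + b) r *
      ((1 + a / b) ^ M * Real.exp (-(a / b) * (nsq r / (a + b)))) := by
    have e1 : ((Real.pi * b) ^ M)⁻¹ = ((Real.pi * (a + b)) ^ M)⁻¹ * (1 + a / b) ^ M := by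
      rw [← inv_pow, ← inv_pow, ← mul_pow]
      congr 1
      field_simp
      ring
    have e2 : -nsq r / b = -nsq r / (a + b) + -(a / b) * (nsq r / (a + b)) := by
      field_simp
      ring
    simp only [vgauss]
    rw [e1, e2, Real.exp_add]
    ring
  rw [hv, oddsDenom]
  field_simp
  ring

lemma integral_pow_mul_exp_mul_inv_oddsDenom (lam : ℝ) (M : ℕ) {a b : ℝ} (ha : 0 < a)
    (hb : 0 < b) :
    ∫ t in Ioi (0 : ℝ), t ^ M * (Real.exp (-t / (a + b)) * (oddsDenom lam M a b t)⁻¹) =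
      (a + b) ^ (M + 1) * phibar lam M (a / b) := by
  have hG : 0 < a + b := by positivity
  have h := integral_comp_mul_left_Ioi (fun t =>
    t ^ M * (Real.exp (-t / (a + b)) * (oddsDenom lam M a b t)⁻¹)) 0 hG
  rw [mul_zero, smul_eq_mul, eq_inv_mul_iff_mul_eq₀ hG.ne'] at h
  rw [← h, phibar, pow_succ', mul_assoc, ← integral_const_mul ((a + b) ^ M)]
  congr 2; ext t
  simp only [oddsDenom]
  rw [mul_div_cancel_left₀ t hG.ne', show -((a + b) * t) / (a + b) = -t by field_simp, mul_pow]
  ring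

lemma continuous_oddsDenom (lam : ℝ) (M : ℕ) (a b : ℝ) : Continuous (oddsDenom lam M a b) := by
  unfold oddsDenom; fun_prop

lemma integrable_vgauss_mul_inv_oddsDenom {lam : ℝ} (hlam : lam ∈ Ioo (0 : ℝ) 1) {M : ℕ}
    (hM : 1 ≤ M) {a b : ℝ} (ha : 0 < a) (hb : 0 < b) (i j : Fin M) :
    Integrable (fun r : Fin M → ℂ => (vgauss M (a + b) r : ℂ) *
      ((((oddsDenom lam M a b (nsq r))⁻¹ : ℝ) : ℂ) * (r i * star (r j)))) := by
  have hD := fun t => one_le_oddsDenom hlam M ha hb t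
  refine integrable_vgauss_mul hM (by positivity) ?_ fun r => ?_
  · refine (Complex.continuous_ofReal.comp (((continuous_oddsDenom lam M a b).comp
      continuous_nsq).inv₀ fun r => ?_)).mul (by fun_prop)
    exact (zero_lt_one.trans_le (hD _)).ne'
  · have h0 : 0 ≤ (oddsDenom lam M a b (nsq r))⁻¹ :=
      inv_nonneg.2 (zero_le_one.trans (hD _))
    rw [norm_mul, Complex.norm_real, Real.norm_of_nonneg h0]
    have := mul_le_mul (inv_le_one_of_one_le₀ (hD (nsq r))) (norm_apply_mul_star_le_nsq r i j)
      (norm_nonneg _) zero_le_one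
    linarith

lemma integral_vgauss_mul_inv_oddsDenom {lam : ℝ} (hlam : lam ∈ Ioo (0 : ℝ) 1) {M : ℕ}
    (hM : 1 ≤ M) {a b : ℝ} (ha : 0 < a) (hb : 0 < b) (i j : Fin M) :
    ∫ r : Fin M → ℂ, (vgauss M (a + b) r : ℂ) *
      ((((oddsDenom lam M a b (nsq r))⁻¹ : ℝ) : ℂ) * (r i * star (r j))) =
      (((a + b) * (phibar lam M (a / b) / M !) : ℝ) : ℂ) *
        (1 : Matrix (Fin M) (Fin M) ℂ) i j := by
  have hG : 0 < a + b := by positivity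
  let f : ℝ → ℝ := fun t => ((Real.pi * (a + b)) ^ M)⁻¹ *
    (Real.exp (-t / (a + b)) * (oddsDenom lam M a b t)⁻¹)
  have hfv : ∀ r : Fin M → ℂ, f (nsq r) =
      vgauss M (a + b) r * (oddsDenom lam M a b (nsq r))⁻¹ := fun r => by
    simp only [f, vgauss]; ring
  have hf : ∀ i, Integrable (fun r : Fin M → ℂ => f (nsq r) * ‖r i‖ ^ 2) := by
    intro i
    refine (integrable_vgauss_mul_inv_oddsDenom hlam hM ha hb i i).re.congr
      (Filter.Eventually.of_forall fun r => ?_)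
    simp only [← starRingEnd_apply, Complex.mul_conj', hfv, ← Complex.ofReal_pow,
      ← Complex.ofReal_mul]
    exact (Complex.ofReal_re _).trans (mul_assoc _ _ _).symm
  have h := integral_radial_mul hM f hf i j
  have e : ∀ t, t ^ M * f t = ((Real.pi * (a + b)) ^ M)⁻¹ *
      (t ^ M * (Real.exp (-t / (a + b)) * (oddsDenom lam M a b t)⁻¹)) := fun t => by
    simp only [f]; ring
  simp only [e, hfv] at h
  rw [integral_const_mul, integral_pow_mul_exp_mul_inv_oddsDenom lam M ha hb] at h
  simp only [Complex.ofReal_mul (vgauss M (a + b) _), mul_assoc] at h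
  rw [h]
  congr 2
  have := Real.pi_pos
  rw [mul_pow, pow_succ]
  field_simp

lemma norm_vgauss_le {M : ℕ} {v : ℝ} (hv : 0 < v) (r : Fin M → ℂ) :
    ‖vgauss M v r‖ ≤ ((Real.pi * v) ^ M)⁻¹ := by
  have := Real.pi_pos
  rw [Real.norm_of_nonneg (vgauss_nonneg M hv r), vgauss]
  refine mul_le_of_le_one_right (by positivity) (Real.exp_le_one_iff.2 ?_)
  exact div_nonpos_of_nonpos_of_nonneg (neg_nonpos.2 (nsq_nonneg r)) hv.le

lemma integrable_vgauss_mul_vgauss_sub_smul {M : ℕ} (hM : 1 ≤ M) {a b : ℝ} (ha : 0 < a)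
    (hb : 0 < b) (rt : Fin M → ℂ) {h : (Fin M → ℂ) → ℂ} (hc : Continuous h)
    (hle : ∀ r, ‖h r‖ ≤ 1 + nsq r) :
    Integrable (fun r => (vgauss M a r * vgauss M b (rt - r)) • h r) := by
  have hi := (integrable_vgauss_mul hM ha hc hle).bdd_mul
    (f := fun r => (vgauss M b (rt - r) : ℂ)) (c := ((Real.pi * b) ^ M)⁻¹)
    (Complex.continuous_ofReal.comp ((continuous_vgauss M b).comp
      (continuous_const.sub continuous_id))).aestronglyMeasurable
    (Filter.Eventually.of_forall fun r => by
      rw [Complex.norm_real]; exact norm_vgauss_le hb _)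
  refine hi.congr (Filter.Eventually.of_forall fun r => ?_)
  simp only [Complex.real_smul, Complex.ofReal_mul]
  ring

/-- with known large-scale fading `g`, the integrated posterior covariance is a
scalar multiple of the identity, with scalar
`c = λg²τ²/(g²+τ²) + (λg⁴/(g²+τ²))(1 − φ̄_M(g²/τ²)/Γ(M+1))`. -/
theorem stmt13
    (M : ℕ) (hM : 1 ≤ M)
    (g τ lam : ℝ) (hg : 0 < g) (hτ : 0 < τ) (hlam : lam ∈ Set.Ioo (0 : ℝ) 1)
    (m : (Fin M → ℂ) → ℝ)
    (Sg Bouter : (Fin M → ℂ) → Matrix (Fin M) (Fin M) ℂ)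
    (Bg : (Fin M → ℂ) → (Fin M → ℂ))
    (hm : ∀ rt, m rt = (1 - lam) * vgauss M (τ ^ 2) rt + lam * vgauss M (g ^ 2 + τ ^ 2) rt)
    (hSg : ∀ rt, Sg rt =
      lam • ∫ r : Fin M → ℂ,
        (vgauss M (g ^ 2) r * vgauss M (τ ^ 2) (rt - r)) • Matrix.vecMulVec r (star r))
    (hBg : ∀ rt, Bg rt =
      lam • ∫ r : Fin M → ℂ, (vgauss M (g ^ 2) r * vgauss M (τ ^ 2) (rt - r)) • r)
    (hBouter : ∀ rt, Bouter rt = Matrix.vecMulVec (Bg rt) (star (Bg rt))) :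
    ∫ rt : Fin M → ℂ, (Sg rt - (m rt)⁻¹ • Bouter rt) =
      (lam * g ^ 2 * τ ^ 2 / (g ^ 2 + τ ^ 2) +
        lam * g ^ 4 / (g ^ 2 + τ ^ 2) *
          (1 - phibar lam M (g ^ 2 / τ ^ 2) / Real.Gamma (M + 1))) •
        (1 : Matrix (Fin M) (Fin M) ℂ) := by
  have ha : 0 < g ^ 2 := by positivity
  have hb : 0 < τ ^ 2 := by positivity
  rw [show g ^ 4 = (g ^ 2) ^ 2 by ring]
  generalize g ^ 2 = a at *
  generalize τ ^ 2 = b at *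
  have hG : 0 < a + b := by positivity
  have hle : ∀ (i j : Fin M) (r : Fin M → ℂ), ‖r i * star (r j)‖ ≤ 1 + nsq r := fun i j r =>
    (norm_apply_mul_star_le_nsq r i j).trans (by linarith)
  have hS : ∀ rt i j, Sg rt i j = lam * ((vgauss M (a + b) rt : ℂ) *
      ((a * b / (a + b) : ℝ) * (1 : Matrix (Fin M) (Fin M) ℂ) i j +
        ((a / (a + b)) ^ 2 : ℝ) * (rt i * star (rt j)))) := by
    intro rt i j
    rw [hSg, Matrix.smul_apply, Matrix.integral_apply (F := fun r : Fin M → ℂ =>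
      (vgauss M a r * vgauss M b (rt - r)) • Matrix.vecMulVec r (star r)) fun i j =>
      integrable_vgauss_mul_vgauss_sub_smul hM ha hb rt (h := fun r => r i * star (r j))
        (by fun_prop) (hle i j), Complex.real_smul, ← integral_posterior_apply_mul_star hM ha hb]
    rfl
  have hB : ∀ rt i, Bg rt i = lam * ((vgauss M (a + b) rt : ℂ) *
      ((a / (a + b) : ℝ) * rt i)) := by
    intro rt i
    rw [hBg, Pi.smul_apply, eval_integral (f := fun r : Fin M → ℂ =>
      (vgauss M a r * vgauss M b (rt - r)) • r) fun i =>
      integrable_vgauss_mul_vgauss_sub_smul hM ha hb rt (h := fun r => r i)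
        (by fun_prop) (fun r => norm_apply_le_one_add_nsq r i), Complex.real_smul,
      ← integral_posterior_apply hM ha hb]
    rfl
  have hI0 : ∀ i j, Integrable fun rt : Fin M → ℂ => (vgauss M (a + b) rt : ℂ) *
      ((lam * (a * b / (a + b)) : ℝ) * (1 : Matrix (Fin M) (Fin M) ℂ) i j) := by
    intro i j
    have h0 := integrable_vgauss_mul hM hG (h := fun _ => 1) (by fun_prop)
      (fun r => by simpa using nsq_nonneg r)
    simp only [mul_one] at h0
    exact h0.mul_const _
  have hI1 : ∀ i j, Integrable fun rt : Fin M → ℂ => (lam * (a / (a + b)) ^ 2 : ℝ) *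
      ((vgauss M (a + b) rt : ℂ) * (rt i * star (rt j))) := fun i j =>
    (integrable_vgauss_mul hM hG (by fun_prop) (hle i j)).const_mul _
  have hI2 : ∀ i j, Integrable fun rt : Fin M → ℂ => (lam * (a / (a + b)) ^ 2 : ℝ) *
      ((vgauss M (a + b) rt : ℂ) *
        ((((oddsDenom lam M a b (nsq rt))⁻¹ : ℝ) : ℂ) * (rt i * star (rt j)))) := fun i j =>
    (integrable_vgauss_mul_inv_oddsDenom hlam hM ha hb i j).const_mul _
  have hI01 : ∀ i j, Integrable fun rt : Fin M → ℂ => (vgauss M (a + b) rt : ℂ) *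
      ((lam * (a * b / (a + b)) : ℝ) * (1 : Matrix (Fin M) (Fin M) ℂ) i j) +
      (lam * (a / (a + b)) ^ 2 : ℝ) * ((vgauss M (a + b) rt : ℂ) * (rt i * star (rt j))) :=
    fun i j => (hI0 i j).add (hI1 i j)
  have hentry : ∀ rt i j, (Sg rt - (m rt)⁻¹ • Bouter rt) i j =
      (vgauss M (a + b) rt : ℂ) *
        ((lam * (a * b / (a + b)) : ℝ) * (1 : Matrix (Fin M) (Fin M) ℂ) i j) +
      (lam * (a / (a + b)) ^ 2 : ℝ) * ((vgauss M (a + b) rt : ℂ) * (rt i * star (rt j))) -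
      (lam * (a / (a + b)) ^ 2 : ℝ) * ((vgauss M (a + b) rt : ℂ) *
        ((((oddsDenom lam M a b (nsq rt))⁻¹ : ℝ) : ℂ) * (rt i * star (rt j)))) := by
    intro rt i j
    have hp : (vgauss M (a + b) rt : ℂ) ≠ 0 := Complex.ofReal_ne_zero.2 (vgauss_pos M hG rt).ne'
    have hl : (lam : ℂ) ≠ 0 := Complex.ofReal_ne_zero.2 hlam.1.ne'
    have hD : (oddsDenom lam M a b (nsq rt) : ℂ) ≠ 0 := Complex.ofReal_ne_zero.2
      (zero_lt_one.trans_le (one_le_oddsDenom hlam M ha hb _)).ne'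
    rw [Matrix.sub_apply, Matrix.smul_apply, hBouter, Matrix.vecMulVec_apply, Pi.star_apply,
      hS, hB, hB, hm, mixture_eq hlam M ha hb, Complex.real_smul]
    simp only [← starRingEnd_apply, map_mul, Complex.conj_ofReal, Complex.ofReal_inv,
      Complex.ofReal_mul, Complex.ofReal_pow]
    field_simp
  ext i j
  rw [Matrix.integral_apply fun i j => by
    simp only [hentry]; exact (hI01 i j).sub (hI2 i j)]
  simp only [hentry]
  rw [integral_sub (hI01 i j) (hI2 i j), integral_add (hI0 i j) (hI1 i j), integral_mul_const,
    integral_vgauss hM hG, integral_const_mul, integral_const_mul,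
    integral_vgauss_mul_apply_mul_star hM hG, integral_vgauss_mul_inv_oddsDenom hlam hM ha hb,
    Matrix.smul_apply, Complex.real_smul, Real.Gamma_nat_eq_factorial]
  have hG' : (a : ℂ) + b ≠ 0 := by exact_mod_cast hG.ne'
  push_cast
  field_simp
  ring
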